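/- arXiv:1310.7686 — 5 statements merged into one kernel-verified Lean document; each statement's English description precedes it below -/
import Mathlib

section
/- For every real number β with 0 < β ≤ 1, every real T > 0, and every positive integer n, one has λ̃_n(β,T) < λ̃_{n+1}(β,T), μ̃_{n-1}(β,T) < μ̃_n(β,T), and λ̃_n(β,T) < μ̃_n(β,T). -/
open Real

/-- The hyperbolic cotangent. -/
noncomputable def coth (t : ℝ) : ℝ := Real.cosh t / Real.sinh t

/-- The normalized Steklov eigenvalues `λ̃_n(β,T)` (for `n ≥ 1`). -/
noncomputable def lamS (n : ℕ) (β T : ℝ) : ℝ :=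
  (4 * n * π / β) * (coth (n * T) - Real.sqrt ((coth (n * T)) ^ 2 - β))

/-- The normalized Steklov eigenvalues `μ̃_n(β,T)` (with `μ̃_0(β,T) = 8π/(Tβ)`). -/
noncomputable def muS (n : ℕ) (β T : ℝ) : ℝ :=
  if n = 0 then 8 * π / (T * β)
  else (4 * n * π / β) * (coth (n * T) + Real.sqrt ((coth (n * T)) ^ 2 - β))

lemma sinh_lt_self_mul_cosh {t : ℝ} (ht : 0 < t) : sinh t < t * cosh t := by
  have h : StrictMonoOn (fun t : ℝ => t * cosh t - sinh t) (Set.Ici 0) := by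
    apply strictMonoOn_of_deriv_pos (convex_Ici 0) (by fun_prop)
    intro x hx
    rw [interior_Ici, Set.mem_Ioi] at hx
    have hd : HasDerivAt (fun t : ℝ => t * cosh t - sinh t)
        (1 * cosh x + x * sinh x - cosh x) x :=
      ((hasDerivAt_id' x).mul (hasDerivAt_cosh x)).sub (hasDerivAt_sinh x)
    rw [hd.deriv]
    nlinarith [mul_pos hx (sinh_pos_iff.2 hx)]
  have := h Set.self_mem_Ici ht.le ht
  simp only [sinh_zero, zero_mul, sub_zero] at this
  linarith

lemma mul_sinh_lt_mul_sinh {d s : ℝ} (hd : 0 < d) (hds : d < s) : s * sinh d < d * sinh s := by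
  have h : StrictMonoOn (fun t : ℝ => d * sinh t - t * sinh d) (Set.Ici d) := by
    apply strictMonoOn_of_deriv_pos (convex_Ici d) (by fun_prop)
    intro x hx
    rw [interior_Ici, Set.mem_Ioi] at hx
    have hx' : HasDerivAt (fun t : ℝ => d * sinh t - t * sinh d)
        (d * cosh x - 1 * sinh d) x :=
      ((hasDerivAt_sinh x).const_mul d).sub ((hasDerivAt_id' x).mul_const (sinh d))
    rw [hx'.deriv]
    have hc : cosh d ≤ cosh x := by
      rw [cosh_le_cosh, abs_of_pos hd, abs_of_pos (hd.trans hx)]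
      exact hx.le
    nlinarith [sinh_lt_self_mul_cosh hd]
  have := h Set.self_mem_Ici hds.le hds
  simp only at this
  linarith

lemma one_lt_mul_coth {x : ℝ} (hx : 0 < x) : 1 < x * coth x := by
  rw [coth, ← mul_div_assoc, one_lt_div (sinh_pos_iff.2 hx)]
  exact sinh_lt_self_mul_cosh hx

lemma mul_coth_lt_mul_coth {x y : ℝ} (hy : 0 < y) (hyx : y < x) :
    y * coth y < x * coth x := by
  have hx := hy.trans hyx
  rw [coth, coth, ← mul_div_assoc, ← mul_div_assoc,
    div_lt_div_iff₀ (sinh_pos_iff.2 hy) (sinh_pos_iff.2 hx)]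
  have h := mul_sinh_lt_mul_sinh (d := x - y) (s := x + y) (by linarith) (by linarith)
  rw [sinh_add, sinh_sub] at h
  linarith

lemma coth_lt_coth {x y : ℝ} (hy : 0 < y) (hyx : y < x) : coth x < coth y := by
  have h : 0 < sinh (x - y) := sinh_pos_iff.2 (by linarith)
  rw [sinh_sub] at h
  rw [coth, coth, div_lt_div_iff₀ (sinh_pos_iff.2 (hy.trans hyx)) (sinh_pos_iff.2 hy)]
  linarith

lemma one_lt_coth {x : ℝ} (hx : 0 < x) : 1 < coth x := by
  rw [coth, one_lt_div (sinh_pos_iff.2 hx)]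
  exact sinh_lt_cosh x

lemma coth_sq {x : ℝ} (hx : 0 < x) : coth x ^ 2 = (sinh x)⁻¹ ^ 2 + 1 := by
  have := (sinh_pos_iff.2 hx).ne'
  rw [coth]
  field_simp
  rw [cosh_sq, add_comm]

lemma coth_half {x : ℝ} (hx : 0 < x) : coth (x / 2) = coth x + (sinh x)⁻¹ := by
  have hs := (sinh_pos_iff.2 (half_pos hx)).ne'
  have hc := (cosh_pos (x / 2)).ne'
  have h : coth (x / 2) = coth (2 * (x / 2)) + (sinh (2 * (x / 2)))⁻¹ := by
    rw [coth, coth, sinh_two_mul, cosh_two_mul]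
    field_simp
    linarith [cosh_sq (x / 2)]
  rwa [mul_div_cancel₀ x two_ne_zero] at h

/-- The square root in the eigenvalues exceeds its value at `β = 1` by a quotient
whose denominator decreases with `x`. -/
lemma sqrt_coth_sq_sub {β x : ℝ} (hβ1 : β ≤ 1) (hx : 0 < x) :
    √(coth x ^ 2 - β) = (sinh x)⁻¹ + (1 - β) / (√(coth x ^ 2 - β) + (sinh x)⁻¹) := by
  have hs : 0 < (sinh x)⁻¹ := inv_pos.2 (sinh_pos_iff.2 hx)
  have hr := sqrt_nonneg (coth x ^ 2 - β)
  have hsq : √(coth x ^ 2 - β) ^ 2 = coth x ^ 2 - β :=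
    sq_sqrt (by nlinarith [one_lt_coth hx])
  rw [coth_sq hx] at hsq hr ⊢
  rw [← sub_eq_iff_eq_add', eq_div_iff (by linarith)]
  linarith

lemma sqrt_coth_sq_sub_le {β x y : ℝ} (hy : 0 < y) (hyx : y < x) :
    √(coth x ^ 2 - β) ≤ √(coth y ^ 2 - β) :=
  sqrt_le_sqrt (by nlinarith [one_lt_coth (hy.trans hyx), coth_lt_coth hy hyx])

lemma mul_coth_add_sqrt {β x : ℝ} (hβ1 : β ≤ 1) (hx : 0 < x) :
    x * (coth x + √(coth x ^ 2 - β)) =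
      2 * (x / 2 * coth (x / 2)) + x * ((1 - β) / (√(coth x ^ 2 - β) + (sinh x)⁻¹)) := by
  rw [coth_half hx]
  linear_combination x * sqrt_coth_sq_sub hβ1 hx

lemma two_lt_mul_coth_add_sqrt {β x : ℝ} (hβ1 : β ≤ 1) (hx : 0 < x) :
    2 < x * (coth x + √(coth x ^ 2 - β)) := by
  have hs : 0 < sinh x := sinh_pos_iff.2 hx
  have hu : 0 ≤ 1 - β := by linarith
  have : 0 ≤ x * ((1 - β) / (√(coth x ^ 2 - β) + (sinh x)⁻¹)) := by positivity
  rw [mul_coth_add_sqrt hβ1 hx]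
  linarith [one_lt_mul_coth (half_pos hx)]

lemma mul_coth_add_sqrt_lt {β x y : ℝ} (hβ1 : β ≤ 1) (hy : 0 < y) (hyx : y < x) :
    y * (coth y + √(coth y ^ 2 - β)) < x * (coth x + √(coth x ^ 2 - β)) := by
  have hx := hy.trans hyx
  have hsy : 0 < sinh y := sinh_pos_iff.2 hy
  have hsx : 0 < sinh x := sinh_pos_iff.2 hx
  have hs : sinh y ≤ sinh x := sinh_le_sinh.2 hyx.le
  have hu : 0 ≤ 1 - β := by linarith
  have hr := sqrt_coth_sq_sub_le (β := β) hy hyx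
  rw [mul_coth_add_sqrt hβ1 hx, mul_coth_add_sqrt hβ1 hy]
  have h := mul_coth_lt_mul_coth (half_pos hy) (div_lt_div_of_pos_right hyx two_pos)
  have : y * ((1 - β) / (√(coth y ^ 2 - β) + (sinh y)⁻¹)) ≤
      x * ((1 - β) / (√(coth x ^ 2 - β) + (sinh x)⁻¹)) := by
    gcongr
  linarith

lemma coth_sub_sqrt {β x : ℝ} (hβ1 : β ≤ 1) (hx : 0 < x) :
    coth x - √(coth x ^ 2 - β) = β / (coth x + √(coth x ^ 2 - β)) := by
  have hc := one_lt_coth hx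
  have hr := sqrt_nonneg (coth x ^ 2 - β)
  rw [eq_div_iff (by linarith)]
  linarith [sq_sqrt (show 0 ≤ coth x ^ 2 - β by nlinarith)]

lemma mul_coth_sub_sqrt_lt {β x y : ℝ} (hβ : 0 < β) (hβ1 : β ≤ 1) (hy : 0 < y) (hyx : y < x) :
    y * (coth y - √(coth y ^ 2 - β)) < x * (coth x - √(coth x ^ 2 - β)) := by
  have hx := hy.trans hyx
  have hcx := one_lt_coth hx
  have hr := sqrt_coth_sq_sub_le (β := β) hy hyx
  have hc := coth_lt_coth hy hyx
  have hrx := sqrt_nonneg (coth x ^ 2 - β)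
  rw [coth_sub_sqrt hβ1 hx, coth_sub_sqrt hβ1 hy]
  exact mul_lt_mul hyx (div_le_div_of_nonneg_left hβ.le (by linarith) (by linarith))
    (div_pos hβ (by linarith)) hx.le

lemma lamS_eq (n : ℕ) (β : ℝ) {T : ℝ} (hT : 0 < T) :
    lamS n β T = 4 * π / (T * β) * (n * T * (coth (n * T) - √(coth (n * T) ^ 2 - β))) := by
  rw [lamS]
  field_simp

lemma muS_eq {n : ℕ} (hn : n ≠ 0) (β : ℝ) {T : ℝ} (hT : 0 < T) :
    muS n β T = 4 * π / (T * β) * (n * T * (coth (n * T) + √(coth (n * T) ^ 2 - β))) := by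
  rw [muS, if_neg hn]
  field_simp

theorem eigenvalue_orderings (β T : ℝ) (hβ : 0 < β) (hβ1 : β ≤ 1) (hT : 0 < T)
    (n : ℕ) (hn : 1 ≤ n) :
    lamS n β T < lamS (n + 1) β T ∧ muS (n - 1) β T < muS n β T ∧
      lamS n β T < muS n β T := by
  have hn0 : (0 : ℝ) < n := by exact_mod_cast hn
  have hC : 0 < 4 * π / (T * β) := by positivity
  have hx : 0 < n * T := by positivity
  refine ⟨?_, ?_, ?_⟩
  · rw [lamS_eq _ _ hT, lamS_eq _ _ hT]
    refine mul_lt_mul_of_pos_left (mul_coth_sub_sqrt_lt hβ hβ1 hx ?_) hC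
    push_cast
    linarith
  · rw [muS_eq (n := n) (by lia) _ hT]
    obtain rfl | hn1 := hn.eq_or_lt
    · have h : muS (1 - 1) β T = 4 * π / (T * β) * 2 := by
        rw [muS, if_pos rfl]
        ring
      rw [h]
      exact mul_lt_mul_of_pos_left (two_lt_mul_coth_add_sqrt hβ1 hx) hC
    · rw [muS_eq (n := n - 1) (by lia) _ hT]
      have hm : (0 : ℝ) < (n - 1 : ℕ) := by exact_mod_cast Nat.sub_pos_of_lt hn1
      have hlt : ((n - 1 : ℕ) : ℝ) < n := by exact_mod_cast Nat.sub_lt hn one_pos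
      exact mul_lt_mul_of_pos_left (mul_coth_add_sqrt_lt hβ1 (mul_pos hm hT)
        (mul_lt_mul_of_pos_right hlt hT)) hC
  · rw [lamS_eq _ _ hT, muS_eq (by lia) _ hT]
    have hr : 0 < √(coth (n * T) ^ 2 - β) := sqrt_pos.2 (by nlinarith [one_lt_coth hx])
    exact mul_lt_mul_of_pos_left (mul_lt_mul_of_pos_left (by linarith) hx) hC
end

section
/- Let k and l be positive integers, let α ≥ 1 be real and set β = 4α/(1+α)². Then there exists T > 0 with λ̃_k(β,T) = μ̃_l(β,T) if and only if α < k/l; moreover, when it exists, such T is unique. -/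
open Real

open Filter Topology Set

theorem coth_eq_one_add {t : ℝ} (ht : 0 < t) : coth t = 1 + 2 / (Real.exp (2 * t) - 1) := by
  have h1 : 1 < Real.exp t := Real.one_lt_exp_iff.2 ht
  have h2 : Real.exp (2 * t) = Real.exp t ^ 2 := by rw [two_mul, Real.exp_add, sq]
  have h3 : Real.exp t ^ 2 - 1 ≠ 0 := by nlinarith
  have h4 : Real.sinh t ≠ 0 := (Real.sinh_pos_iff.2 ht).ne'
  rw [coth, h2, div_eq_iff h4, Real.cosh_eq, Real.sinh_eq, Real.exp_neg]
  field_simp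
  ring

theorem one_lt_coth_s8 {t : ℝ} (ht : 0 < t) : 1 < coth t := by
  have h : 1 < Real.exp (2 * t) := Real.one_lt_exp_iff.2 (by positivity)
  rw [coth_eq_one_add ht]
  exact lt_add_of_pos_right 1 (div_pos two_pos (by linarith))

theorem coth_strictAntiOn : StrictAntiOn coth (Ioi 0) := by
  intro s hs t ht hst
  have h : 1 < Real.exp (2 * s) := Real.one_lt_exp_iff.2 (mul_pos two_pos hs)
  rw [coth_eq_one_add hs, coth_eq_one_add ht]
  gcongr

theorem continuousOn_coth : ContinuousOn coth (Ioi 0) :=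
  Real.continuous_cosh.continuousOn.div Real.continuous_sinh.continuousOn
    fun _ ht => (Real.sinh_pos_iff.2 ht).ne'

theorem tendsto_coth_atTop : Tendsto coth atTop (𝓝 1) := by
  have h : Tendsto (fun t : ℝ => Real.exp (2 * t) - 1) atTop atTop :=
    tendsto_atTop_add_const_right _ (-1)
      (Real.tendsto_exp_atTop.comp (tendsto_id.const_mul_atTop two_pos))
  have h2 : Tendsto (fun t : ℝ => 1 + 2 / (Real.exp (2 * t) - 1)) atTop (𝓝 (1 + 0)) :=
    (h.const_div_atTop 2).const_add 1
  rw [add_zero] at h2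
  refine h2.congr' ?_
  filter_upwards [eventually_gt_atTop 0] with t ht using (coth_eq_one_add ht).symm

theorem exists_coth_eq {c : ℝ} (hc : 1 < c) : ∃ t, 0 < t ∧ coth t = c := by
  have h : 0 < 2 / (c - 1) := div_pos two_pos (by linarith)
  have h0 : c - 1 ≠ 0 := by linarith
  have ht : 0 < Real.log (1 + 2 / (c - 1)) / 2 := half_pos (Real.log_pos (by linarith))
  refine ⟨_, ht, ?_⟩
  rw [coth_eq_one_add ht, mul_div_cancel₀ _ two_ne_zero, Real.exp_log (by linarith)]
  field_simp
  ring

/-- The larger root of `x ^ 2 - 2 * c * x + β = 0`. -/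
noncomputable def largerRoot (β c : ℝ) : ℝ := c + Real.sqrt (c ^ 2 - β)

theorem le_largerRoot (β c : ℝ) : c ≤ largerRoot β c :=
  le_add_of_nonneg_right (Real.sqrt_nonneg _)

theorem largerRoot_strictMonoOn (β : ℝ) : StrictMonoOn (largerRoot β) (Ici 0) := by
  intro c hc d _ hcd
  have hc' : 0 ≤ c := hc
  exact add_lt_add_of_lt_of_le hcd (Real.sqrt_le_sqrt (by gcongr))

theorem continuous_largerRoot (β : ℝ) : Continuous (largerRoot β) := by
  unfold largerRoot
  fun_prop

theorem largerRoot_one {α : ℝ} (hα : 1 ≤ α) :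
    largerRoot (4 * α / (1 + α) ^ 2) 1 = 2 * α / (1 + α) := by
  have h : (1 : ℝ) ^ 2 - 4 * α / (1 + α) ^ 2 = ((α - 1) / (1 + α)) ^ 2 := by
    field_simp
    ring
  rw [largerRoot, h, Real.sqrt_sq (div_nonneg (by linarith) (by linarith))]
  field_simp
  ring

/-- The product of the larger roots at `coth (k * T)` and `coth (l * T)`. -/
noncomputable def rootProduct (k l : ℕ) (β T : ℝ) : ℝ :=
  largerRoot β (coth (k * T)) * largerRoot β (coth (l * T))

section

variable {k l : ℕ}

theorem lamS_eq_muS_iff {β T : ℝ} (hk : 1 ≤ k) (hl : 1 ≤ l) (hβ : 0 < β) (hβ1 : β ≤ 1)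
    (hT : 0 < T) : lamS k β T = muS l β T ↔ rootProduct k l β T = β * (k / l) := by
  have hk0 : (0 : ℝ) < k := by exact_mod_cast hk
  have hl0 : (0 : ℝ) < l := by exact_mod_cast hl
  have ha := one_lt_coth_s8 (mul_pos hk0 hT)
  have hg : 0 < largerRoot β (coth (k * T)) := by linarith [le_largerRoot β (coth (k * T))]
  have hconj : (coth (k * T) - Real.sqrt (coth (k * T) ^ 2 - β)) * largerRoot β (coth (k * T))
      = β := by
    have := Real.sq_sqrt (show 0 ≤ coth (k * T) ^ 2 - β by nlinarith)
    rw [largerRoot]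
    linarith [this]
  rw [lamS, muS, if_neg (by lia), rootProduct, ← largerRoot, eq_comm,
    ← mul_left_inj' hg.ne', mul_assoc (4 * k * π / β), hconj]
  have hπ := Real.pi_pos
  field_simp

theorem rootProduct_strictAntiOn (hk : 1 ≤ k) (hl : 1 ≤ l) (β : ℝ) :
    StrictAntiOn (rootProduct k l β) (Ioi 0) := by
  have key : ∀ n : ℕ, 1 ≤ n → ∀ S T : ℝ, 0 < S → S < T →
      largerRoot β (coth (n * T)) < largerRoot β (coth (n * S)) ∧
        0 < largerRoot β (coth (n * T)) := by
    intro n hn S T hS hST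
    have hn0 : (0 : ℝ) < n := by exact_mod_cast hn
    have hnT := mul_pos hn0 (hS.trans hST)
    have h1 := one_lt_coth_s8 hnT
    have h2 := coth_strictAntiOn (mul_pos hn0 hS) hnT (mul_lt_mul_of_pos_left hST hn0)
    exact ⟨largerRoot_strictMonoOn β (show (0 : ℝ) ≤ _ by linarith)
      (show (0 : ℝ) ≤ _ by linarith) h2, by linarith [le_largerRoot β (coth (n * T))]⟩
  intro S hS T _ hST
  obtain ⟨h1, h2⟩ := key k hk S T hS hST
  obtain ⟨h3, h4⟩ := key l hl S T hS hST
  exact mul_lt_mul'' h1 h3 h2.le h4.le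

theorem continuousOn_rootProduct (hk : 1 ≤ k) (hl : 1 ≤ l) (β : ℝ) :
    ContinuousOn (rootProduct k l β) (Ioi 0) := by
  have key : ∀ n : ℕ, 1 ≤ n → ContinuousOn (fun T : ℝ => largerRoot β (coth (n * T))) (Ioi 0) :=
    fun n hn => (continuous_largerRoot β).comp_continuousOn
      (continuousOn_coth.comp (by fun_prop) fun T hT =>
        mul_pos (show (0 : ℝ) < n by exact_mod_cast hn) hT)
  exact (key k hk).mul (key l hl)

theorem tendsto_rootProduct (hk : 1 ≤ k) (hl : 1 ≤ l) (β : ℝ) :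
    Tendsto (rootProduct k l β) atTop (𝓝 (largerRoot β 1 * largerRoot β 1)) := by
  have key : ∀ n : ℕ, 1 ≤ n →
      Tendsto (fun T : ℝ => largerRoot β (coth (n * T))) atTop (𝓝 (largerRoot β 1)) :=
    fun n hn => ((continuous_largerRoot β).tendsto 1).comp
      (tendsto_coth_atTop.comp (tendsto_id.const_mul_atTop
        (show (0 : ℝ) < n by exact_mod_cast hn)))
  exact (key k hk).mul (key l hl)

theorem exists_rootProduct_eq_iff (hk : 1 ≤ k) (hl : 1 ≤ l) (β : ℝ) {y : ℝ} (hy : 0 < y) :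
    (∃ T, 0 < T ∧ rootProduct k l β T = y) ↔ largerRoot β 1 * largerRoot β 1 < y := by
  constructor
  · rintro ⟨T, hT, rfl⟩
    have h1 := rootProduct_strictAntiOn hk hl β hT (show (0 : ℝ) < T + 1 by linarith)
      (lt_add_one T)
    refine lt_of_le_of_lt (le_of_tendsto (tendsto_rootProduct hk hl β) ?_) h1
    filter_upwards [eventually_ge_atTop (T + 1)] with S hS
    exact (rootProduct_strictAntiOn hk hl β).antitoneOn (show (0 : ℝ) < T + 1 by linarith)
      (show (0 : ℝ) < S by linarith) hS
  · intro h
    have hk0 : (0 : ℝ) < k := by exact_mod_cast hk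
    have hl0 : (0 : ℝ) < l := by exact_mod_cast hl
    obtain ⟨B, hB, hB0⟩ := (((tendsto_rootProduct hk hl β).eventually_lt_const h).and
      (eventually_gt_atTop 0)).exists
    obtain ⟨t, ht, htc⟩ := exists_coth_eq (lt_add_of_pos_right 1 hy)
    have hA0 : 0 < t / k := div_pos ht hk0
    have hA : y ≤ rootProduct k l β (t / k) := by
      have h1 := le_largerRoot β (1 + y)
      have h2 := le_largerRoot β (coth (l * (t / k)))
      have h3 := one_lt_coth_s8 (mul_pos hl0 hA0)
      rw [rootProduct, mul_div_cancel₀ _ hk0.ne', htc]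
      nlinarith
    exact isPreconnected_Ioi.intermediate_value hB0 hA0 (continuousOn_rootProduct hk hl β)
      ⟨hB.le, hA⟩

end

theorem intersection_iff_alpha_lt (k l : ℕ) (hk : 1 ≤ k) (hl : 1 ≤ l)
    (α β : ℝ) (hα : 1 ≤ α) (hβ : β = 4 * α / (1 + α) ^ 2) :
    ((∃ T : ℝ, 0 < T ∧ lamS k β T = muS l β T) ↔ α < (k : ℝ) / l) ∧
    (∀ T T' : ℝ, 0 < T → 0 < T' →
      lamS k β T = muS l β T → lamS k β T' = muS l β T' → T = T') := by
  have hk0 : (0 : ℝ) < k := by exact_mod_cast hk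
  have hl0 : (0 : ℝ) < l := by exact_mod_cast hl
  have hα0 : 0 < α := by linarith
  have hβ0 : 0 < β := by rw [hβ]; positivity
  have hβ1 : β ≤ 1 := by
    rw [hβ, div_le_one (by positivity)]
    nlinarith [sq_nonneg (α - 1)]
  constructor
  · have hsq : largerRoot β 1 * largerRoot β 1 = β * α := by
      rw [hβ, largerRoot_one hα]
      field_simp
      ring
    rw [← mul_lt_mul_iff_right₀ hβ0, ← hsq,
      ← exists_rootProduct_eq_iff hk hl β (by positivity)]
    exact exists_congr fun T => and_congr_right (lamS_eq_muS_iff hk hl hβ0 hβ1)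
  · intro T T' hT hT' h h'
    rw [lamS_eq_muS_iff hk hl hβ0 hβ1 hT] at h
    rw [lamS_eq_muS_iff hk hl hβ0 hβ1 hT'] at h'
    exact (rootProduct_strictAntiOn hk hl β).injOn hT hT' (h.trans h'.symm)
end

section
/- For every real number β with 0 ≤ β ≤ 1, the function f_β(t) = (sinh(t)²·√(coth(t)² − β) − t)/t² is strictly increasing on (0, ∞). -/
open Real

/-- A function vanishing at zero with positive derivative on the positive axis is positive there. -/
lemma pos_of_hasDerivAt_pos {k k' : ℝ → ℝ} (h0 : k 0 = 0)
    (hd : ∀ x, HasDerivAt k (k' x) x) (hpos : ∀ x, 0 < x → 0 < k' x) {x : ℝ} (hx : 0 < x) :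
    0 < k x := by
  have hmono : StrictMonoOn k (Set.Ici 0) := by
    refine strictMonoOn_of_deriv_pos (convex_Ici 0)
      (fun y _ => (hd y).continuousAt.continuousWithinAt) fun y hy => ?_
    rw [interior_Ici] at hy
    rw [(hd y).deriv]
    exact hpos y hy
  simpa [h0] using hmono Set.self_mem_Ici hx.le hx

/-- If `g` vanishes at zero, has slope one there and a positive third derivative on the positive
axis, then `(g t - t) / t ^ 2` is strictly increasing on the positive axis. -/
lemma strictMonoOn_sub_div_sq {g g₁ g₂ g₃ : ℝ → ℝ} (hg : ∀ x, HasDerivAt g (g₁ x) x)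
    (hg₁ : ∀ x, HasDerivAt g₁ (g₂ x) x) (hg₂ : ∀ x, HasDerivAt g₂ (g₃ x) x)
    (h0 : g 0 = 0) (h1 : g₁ 0 = 1) (hpos : ∀ x, 0 < x → 0 < g₃ x) :
    StrictMonoOn (fun t => (g t - t) / t ^ 2) (Set.Ioi 0) := by
  have hfirst : ∀ x, 0 < x → 0 < x * g₂ x - g₁ x + 1 := fun x hx =>
    pos_of_hasDerivAt_pos (k := fun x => x * g₂ x - g₁ x + 1) (k' := fun x => x * g₃ x)
      (by simp [h1])
      (fun y => ((((hasDerivAt_id' y).mul (hg₂ y)).sub (hg₁ y)).add_const 1).congr_deriv (by ring))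
      (fun y hy => mul_pos hy (hpos y hy)) hx
  have hzeroth : ∀ x, 0 < x → 0 < x * g₁ x - 2 * g x + x := fun x hx =>
    pos_of_hasDerivAt_pos (k := fun x => x * g₁ x - 2 * g x + x)
      (k' := fun x => x * g₂ x - g₁ x + 1) (by simp [h0])
      (fun y => ((((hasDerivAt_id' y).mul (hg₁ y)).sub ((hg y).const_mul 2)).add
        (hasDerivAt_id' y)).congr_deriv (by ring))
      hfirst hx
  have hf : ∀ x, 0 < x → HasDerivAt (fun t => (g t - t) / t ^ 2)
      ((x * g₁ x - 2 * g x + x) / x ^ 3) x := by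
    intro x hx
    refine (((hg x).sub (hasDerivAt_id' x)).div (hasDerivAt_pow 2 x)
      (by positivity)).congr_deriv ?_
    simp only [Pi.sub_apply]
    field_simp
    ring
  refine strictMonoOn_of_deriv_pos (convex_Ioi 0)
    (fun y hy => (hf y hy).continuousAt.continuousWithinAt) fun y hy => ?_
  rw [interior_Ioi] at hy
  rw [(hf y hy).deriv]
  exact div_pos (hzeroth y hy) (pow_pos hy 3)

lemma hasDerivAt_sqrt_one_add_mul_sinh_sq {γ : ℝ} (hγ : 0 ≤ γ) (x : ℝ) :
    HasDerivAt (fun t => √(1 + γ * sinh t ^ 2))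
      (γ * sinh x * cosh x / √(1 + γ * sinh x ^ 2)) x := by
  have hpos : 0 < 1 + γ * sinh x ^ 2 := by positivity
  refine (((((hasDerivAt_sinh x).pow 2).const_mul γ).const_add 1).sqrt hpos.ne').congr_deriv ?_
  simp only [Pi.pow_apply]
  field_simp
  ring

lemma strictMonoOn_sinh_mul_sqrt_sub_div_sq {γ : ℝ} (hγ : 0 ≤ γ) :
    StrictMonoOn (fun t => (sinh t * √(1 + γ * sinh t ^ 2) - t) / t ^ 2) (Set.Ioi 0) := by
  have hR := hasDerivAt_sqrt_one_add_mul_sinh_sq hγ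
  have hRpos : ∀ x, 0 < √(1 + γ * sinh x ^ 2) := fun x => by positivity
  have hRsq : ∀ x, √(1 + γ * sinh x ^ 2) ^ 2 = 1 + γ * sinh x ^ 2 := fun x =>
    Real.sq_sqrt (by positivity)
  refine strictMonoOn_sub_div_sq (g := fun t => sinh t * √(1 + γ * sinh t ^ 2))
    (g₁ := fun t => cosh t * (1 + 2 * γ * sinh t ^ 2) / √(1 + γ * sinh t ^ 2))
    (g₂ := fun t => sinh t * ((1 + 3 * γ) + (6 * γ + 2 * γ ^ 2) * sinh t ^ 2
      + 4 * γ ^ 2 * sinh t ^ 4) / √(1 + γ * sinh t ^ 2) ^ 3)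
    (g₃ := fun t => cosh t * ((1 + 3 * γ) + 16 * γ * sinh t ^ 2 + 20 * γ ^ 2 * sinh t ^ 4
      + 8 * γ ^ 3 * sinh t ^ 6) / √(1 + γ * sinh t ^ 2) ^ 5)
    (fun x => ?_) (fun x => ?_) (fun x => ?_) (by simp) (by simp) (fun x _ => ?_)
  · refine ((hasDerivAt_sinh x).mul (hR x)).congr_deriv ?_
    have hp := hRpos x
    have hs := hRsq x
    set R := √(1 + γ * sinh x ^ 2)
    field_simp
    rw [hs]
    ring
  · refine (((hasDerivAt_cosh x).mul ((((hasDerivAt_sinh x).pow 2).const_mul (2 * γ)).const_add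
      1)).div (hR x) (hRpos x).ne').congr_deriv ?_
    have hp := hRpos x
    have hs := hRsq x
    have hc := cosh_sq x
    simp only [Pi.pow_apply, Pi.mul_apply]
    set R := √(1 + γ * sinh x ^ 2)
    field_simp
    simp only [hs, hc]
    ring
  · refine (((hasDerivAt_sinh x).mul
      (((((hasDerivAt_sinh x).pow 2).const_mul (6 * γ + 2 * γ ^ 2)).const_add (1 + 3 * γ)).add
        (((hasDerivAt_sinh x).pow 4).const_mul (4 * γ ^ 2)))).div ((hR x).pow 3)
      (pow_pos (hRpos x) 3).ne').congr_deriv ?_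
    have hp := hRpos x
    have hs := hRsq x
    simp only [Pi.pow_apply, Pi.mul_apply, Pi.add_apply]
    set R := √(1 + γ * sinh x ^ 2)
    field_simp
    rw [show R ^ 4 = (R ^ 2) ^ 2 by ring, hs]
    ring
  · have := hRpos x
    have := cosh_pos x
    positivity

theorem f_beta_strictMono (β : ℝ) (hβ0 : 0 ≤ β) (hβ1 : β ≤ 1) :
    StrictMonoOn
      (fun t => (Real.sinh t ^ 2 * Real.sqrt ((coth t) ^ 2 - β) - t) / t ^ 2)
      (Set.Ioi 0) := by
  refine (strictMonoOn_sinh_mul_sqrt_sub_div_sq (sub_nonneg.2 hβ1)).congr fun t ht => ?_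
  have hs : 0 < sinh t := sinh_pos_iff.2 ht
  have hsq : coth t ^ 2 - β = (1 + (1 - β) * sinh t ^ 2) / sinh t ^ 2 := by
    rw [coth, div_pow, cosh_sq]
    field_simp
    ring
  simp only [hsq, Real.sqrt_div' _ (sq_nonneg (sinh t)), Real.sqrt_sq hs.le]
  field_simp
end

section
/- Let β be real with 0 < β ≤ 1 and let a, b, c be reals with a > b ≥ c > 0. Suppose x₁ > 0 satisfies a·(coth(a·x₁) − √(coth(a·x₁)² − β)) = R_b(x₁) and x₂ > 0 satisfies (a+c)·(coth((a+c)·x₂) − √(coth((a+c)·x₂)² − β)) = R_{b−c}(x₂). Then a·(coth(a·x₁) − √(coth(a·x₁)² − β)) < (a+c)·(coth((a+c)·x₂) − √(coth((a+c)·x₂)² − β)). -/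
open Real

/-- `R_{b}(x)` : for `b > 0` this is `b(coth(bx) + √(coth²(bx) − β))`, and `R_0(x) = 2/x`. -/
noncomputable def RS (β b x : ℝ) : ℝ :=
  if b = 0 then 2 / x
  else b * (coth (b * x) + Real.sqrt ((coth (b * x)) ^ 2 - β))

open Set Filter Topology

/-- The root `√(1 + (1 - β) sinh² t)`, equal to `sinh t * √(coth² t - β)` for `t > 0`. -/
noncomputable def rootS (β t : ℝ) : ℝ := √(1 + (1 - β) * Real.sinh t ^ 2)

/-- The reciprocal of `coth t + √(coth² t - β)`, extended smoothly to all of `ℝ`. -/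
noncomputable def recipS (β t : ℝ) : ℝ := Real.sinh t / (Real.cosh t + rootS β t)

section

variable {β : ℝ}

lemma one_le_rootS (hβ1 : β ≤ 1) (t : ℝ) : 1 ≤ rootS β t :=
  Real.one_le_sqrt.mpr (by nlinarith [mul_nonneg (sub_nonneg.mpr hβ1) (sq_nonneg (Real.sinh t))])

lemma rootS_sq (hβ1 : β ≤ 1) (t : ℝ) : rootS β t ^ 2 = 1 + (1 - β) * Real.sinh t ^ 2 :=
  Real.sq_sqrt (by nlinarith [mul_nonneg (sub_nonneg.mpr hβ1) (sq_nonneg (Real.sinh t))])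

lemma recipS_zero : recipS β 0 = 0 := by simp [recipS]

lemma recipS_pos (hβ1 : β ≤ 1) {t : ℝ} (ht : 0 < t) : 0 < recipS β t :=
  div_pos (Real.sinh_pos_iff.mpr ht)
    (add_pos (Real.cosh_pos t) (one_pos.trans_le (one_le_rootS hβ1 t)))

lemma recipS_lt_one (hβ1 : β ≤ 1) (t : ℝ) : recipS β t < 1 := by
  have hp := one_le_rootS hβ1 t
  have hc := Real.cosh_pos t
  rw [recipS, div_lt_one (by positivity)]
  linarith [Real.sinh_lt_cosh t]

lemma sqrt_coth_sq_sub_s12 (hβ1 : β ≤ 1) {t : ℝ} (ht : 0 < t) :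
    √(coth t ^ 2 - β) = rootS β t / Real.sinh t := by
  have hs := Real.sinh_pos_iff.mpr ht
  have hp := one_le_rootS hβ1 t
  rw [show coth t ^ 2 - β = (rootS β t / Real.sinh t) ^ 2 by
    rw [coth, div_pow, div_pow, rootS_sq hβ1, Real.cosh_sq]; field_simp; ring]
  exact Real.sqrt_sq (by positivity)

lemma recipS_mul_coth_add (hβ1 : β ≤ 1) {t : ℝ} (ht : 0 < t) :
    (coth t + √(coth t ^ 2 - β)) * recipS β t = 1 := by
  have hs := Real.sinh_pos_iff.mpr ht
  have hp := one_le_rootS hβ1 t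
  have hc := Real.cosh_pos t
  rw [sqrt_coth_sq_sub_s12 hβ1 ht, coth, recipS]
  field_simp

lemma coth_sub_eq (hβ1 : β ≤ 1) {t : ℝ} (ht : 0 < t) :
    coth t - √(coth t ^ 2 - β) = β * recipS β t := by
  have hs := Real.sinh_pos_iff.mpr ht
  have hp := one_le_rootS hβ1 t
  have hc := Real.cosh_pos t
  rw [sqrt_coth_sq_sub_s12 hβ1 ht, coth, recipS]
  field_simp
  linear_combination Real.cosh_sq t - rootS_sq hβ1 t

lemma hasDerivAt_rootS (hβ1 : β ≤ 1) (t : ℝ) :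
    HasDerivAt (rootS β) ((1 - β) * Real.sinh t * Real.cosh t / rootS β t) t := by
  have hp := one_le_rootS hβ1 t
  have h0 : 1 + (1 - β) * Real.sinh t ^ 2 ≠ 0 := by
    rw [← rootS_sq hβ1]; positivity
  have h := ((((Real.hasDerivAt_sinh t).pow 2).const_mul (1 - β)).const_add 1).sqrt h0
  refine h.congr_deriv ?_
  change _ / (2 * rootS β t) = _
  field_simp
  simp

lemma hasDerivAt_recipS (hβ1 : β ≤ 1) (t : ℝ) :
    HasDerivAt (recipS β) (1 / ((Real.cosh t + rootS β t) * rootS β t)) t := by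
  have hp := one_le_rootS hβ1 t
  have hc := Real.cosh_pos t
  have h := (Real.hasDerivAt_sinh t).div ((Real.hasDerivAt_cosh t).add (hasDerivAt_rootS hβ1 t))
    (by simp only [Pi.add_apply]; positivity)
  refine h.congr_deriv ?_
  simp only [Pi.add_apply]
  field_simp
  linear_combination (rootS β t) * Real.cosh_sq t + Real.cosh t * rootS_sq hβ1 t

lemma hasDerivAt_recipS_of_pos (hβ1 : β ≤ 1) {t : ℝ} (ht : 0 < t) :
    HasDerivAt (recipS β) (recipS β t / (Real.sinh t * rootS β t)) t := by
  have hs := Real.sinh_pos_iff.mpr ht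
  refine (hasDerivAt_recipS hβ1 t).congr_deriv ?_
  rw [recipS]
  field_simp

lemma continuous_recipS (hβ1 : β ≤ 1) : Continuous (recipS β) :=
  continuous_iff_continuousAt.mpr fun t => (hasDerivAt_recipS hβ1 t).continuousAt

lemma strictMono_recipS (hβ1 : β ≤ 1) : StrictMono (recipS β) := by
  refine strictMono_of_deriv_pos fun t => ?_
  have hp := one_le_rootS hβ1 t
  have hc := Real.cosh_pos t
  rw [(hasDerivAt_recipS hβ1 t).deriv]
  positivity

lemma two_mul_sinh_le {t : ℝ} (ht : 0 ≤ t) :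
    2 * Real.sinh t ≤ t * (1 + Real.cosh t) := by
  have key : MonotoneOn (fun s : ℝ => s * Real.cosh s - Real.sinh s) (Ici 0) := by
    have hd (s : ℝ) : HasDerivAt (fun s : ℝ => s * Real.cosh s - Real.sinh s)
        (s * Real.sinh s) s :=
      (((hasDerivAt_id s).mul (Real.hasDerivAt_cosh s)).sub
        (Real.hasDerivAt_sinh s)).congr_deriv (by simp)
    refine monotoneOn_of_deriv_nonneg (convex_Ici 0)
      (fun s _ => (hd s).continuousAt.continuousWithinAt)
      (fun s _ => (hd s).differentiableAt.differentiableWithinAt) fun s hs => ?_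
    rw [interior_Ici, mem_Ioi] at hs
    rw [(hd s).deriv]
    exact mul_nonneg hs.le (Real.sinh_nonneg_iff.mpr hs.le)
  have h := key (mem_Ici.mpr le_rfl) (mem_Ici.mpr (by positivity : 0 ≤ t / 2)) (by positivity)
  simp only [zero_mul, Real.sinh_zero, sub_zero] at h
  have h1 := Real.sinh_two_mul (t / 2)
  have h2 := Real.cosh_two_mul (t / 2)
  rw [mul_div_cancel₀ t two_ne_zero] at h1 h2
  rw [h1, h2]
  nlinarith [Real.cosh_sq (t / 2), mul_nonneg (Real.cosh_pos (t / 2)).le h]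

/-- `(sinh t * rootS β t - t) / t²` is nondecreasing on `(0, ∞)`. -/
lemma monotoneOn_sinh_mul_rootS_sub_div_sq (hβ1 : β ≤ 1) :
    MonotoneOn (fun t => (Real.sinh t * rootS β t - t) / t ^ 2) (Ioi 0) := by
  have hd {t : ℝ} (ht : 0 < t) := (((Real.hasDerivAt_sinh t).mul (hasDerivAt_rootS hβ1 t)).sub
    (hasDerivAt_id t)).div ((hasDerivAt_id t).pow 2) (by simp [ht.ne'])
  refine monotoneOn_of_deriv_nonneg (convex_Ioi 0)
    (fun t ht => (hd ht).continuousAt.continuousWithinAt)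
    (fun t ht => (hd (interior_subset ht)).differentiableAt.differentiableWithinAt) fun t ht => ?_
  rw [interior_Ioi, mem_Ioi] at ht
  refine (hd ht).deriv.ge.trans' ?_
  have hp := one_le_rootS hβ1 t
  have hp2 := rootS_sq hβ1 t
  have hs := Real.sinh_pos_iff.mpr ht
  have hc := Real.one_le_cosh t
  have hts := two_mul_sinh_le ht.le
  have hδ : 0 ≤ (1 - β) * Real.sinh t ^ 2 := mul_nonneg (sub_nonneg.mpr hβ1) (sq_nonneg _)
  refine div_nonneg ?_ (by positivity)
  simp only [Pi.sub_apply, Pi.mul_apply, Pi.pow_apply, id_eq]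
  have h1 : 0 ≤ t * Real.cosh t * (1 + 2 * ((1 - β) * Real.sinh t ^ 2)) + t * rootS β t
      - 2 * Real.sinh t * rootS β t ^ 2 := by
    rw [hp2]
    nlinarith [mul_nonneg ht.le (sub_nonneg.mpr hp), mul_nonneg ht.le (sub_nonneg.mpr hc),
      mul_nonneg hδ (by nlinarith : 0 ≤ t * Real.cosh t - Real.sinh t)]
  have h2 : 0 ≤ t / rootS β t := by positivity
  refine (mul_nonneg h2 h1).trans_eq ?_
  field_simp
  norm_num
  linear_combination (-t ^ 2 * Real.cosh t) * hp2

lemma self_lt_sinh_mul_rootS (hβ1 : β ≤ 1) {t : ℝ} (ht : 0 < t) :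
    t < Real.sinh t * rootS β t :=
  (Real.self_lt_sinh_iff.mpr ht).trans_le
    (le_mul_of_one_le_right (Real.sinh_pos_iff.mpr ht).le (one_le_rootS hβ1 t))

lemma continuous_dslope_recipS (hβ1 : β ≤ 1) : Continuous (dslope (recipS β) 0) := by
  rw [← continuousOn_univ, continuousOn_dslope univ_mem]
  exact ⟨(continuous_recipS hβ1).continuousOn, (hasDerivAt_recipS hβ1 0).differentiableAt⟩

lemma dslope_recipS_zero (hβ1 : β ≤ 1) : dslope (recipS β) 0 0 = 1 / 2 := by
  rw [dslope_same, (hasDerivAt_recipS hβ1 0).deriv]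
  norm_num [rootS]

lemma dslope_recipS_of_pos {t : ℝ} (ht : 0 < t) :
    dslope (recipS β) 0 t = recipS β t / t := by
  rw [dslope_of_ne _ ht.ne', slope_def_field, recipS_zero, sub_zero, sub_zero]

lemma dslope_recipS_pos (hβ1 : β ≤ 1) {t : ℝ} (ht : 0 ≤ t) : 0 < dslope (recipS β) 0 t := by
  rcases ht.eq_or_lt with rfl | ht
  · rw [dslope_recipS_zero hβ1]; norm_num
  · rw [dslope_recipS_of_pos ht]
    exact div_pos (recipS_pos hβ1 ht) ht

lemma hasDerivAt_inv_dslope_recipS (hβ1 : β ≤ 1) {t : ℝ} (ht : 0 < t) :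
    HasDerivAt (fun t => (dslope (recipS β) 0 t)⁻¹)
      ((Real.sinh t * rootS β t - t) / (Real.sinh t * rootS β t * recipS β t)) t := by
  have hm := ht.trans (self_lt_sinh_mul_rootS hβ1 ht)
  have hY := recipS_pos hβ1 ht
  have h := (hasDerivAt_id t).div (hasDerivAt_recipS_of_pos hβ1 ht) hY.ne'
  refine (h.congr_of_eventuallyEq ?_).congr_deriv ?_
  · filter_upwards [Ioi_mem_nhds ht] with s hs
    rw [dslope_recipS_of_pos hs, inv_div, Pi.div_apply, id_eq]
  · set m := Real.sinh t * rootS β t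
    simp only [id_eq]
    field_simp

lemma continuousOn_inv_dslope_recipS (hβ1 : β ≤ 1) :
    ContinuousOn (fun t => (dslope (recipS β) 0 t)⁻¹) (Ici 0) :=
  (continuous_dslope_recipS hβ1).continuousOn.inv₀ fun _ ht => (dslope_recipS_pos hβ1 ht).ne'

lemma strictMonoOn_inv_dslope_recipS (hβ1 : β ≤ 1) :
    StrictMonoOn (fun t => (dslope (recipS β) 0 t)⁻¹) (Ici 0) := by
  refine strictMonoOn_of_deriv_pos (convex_Ici 0) (continuousOn_inv_dslope_recipS hβ1)
    fun t ht => ?_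
  rw [interior_Ici, mem_Ioi] at ht
  rw [(hasDerivAt_inv_dslope_recipS hβ1 ht).deriv]
  have hm := self_lt_sinh_mul_rootS hβ1 ht
  exact div_pos (sub_pos.mpr hm) (mul_pos (ht.trans hm) (recipS_pos hβ1 ht))

lemma hasDerivAt_mul_recipS (hβ1 : β ≤ 1) {t : ℝ} (ht : 0 < t) :
    HasDerivAt (fun t => β * (t * recipS β t))
      (β * (recipS β t * (Real.sinh t * rootS β t + t) / (Real.sinh t * rootS β t))) t := by
  have hm := ht.trans (self_lt_sinh_mul_rootS hβ1 ht)
  refine (((hasDerivAt_id t).mul (hasDerivAt_recipS_of_pos hβ1 ht)).const_mul β).congr_deriv ?_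
  set m := Real.sinh t * rootS β t
  simp only [id_eq]
  field_simp

lemma strictMonoOn_mul_recipS (hβ : 0 < β) (hβ1 : β ≤ 1) :
    StrictMonoOn (fun t => β * (t * recipS β t)) (Ioi 0) := fun _ hs _ _ hst =>
  mul_lt_mul_of_pos_left
    (mul_lt_mul'' hst (strictMono_recipS hβ1 hst) hs.le (recipS_pos hβ1 hs).le) hβ

lemma image_mul_recipS (hβ : 0 < β) (hβ1 : β ≤ 1) :
    (fun t => β * (t * recipS β t)) '' Ioi 0 = Ioi 0 := by
  refine Subset.antisymm ?_ fun y hy => ?_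
  · rintro _ ⟨t, ht, rfl⟩
    exact mul_pos hβ (mul_pos ht (recipS_pos hβ1 ht))
  · rw [mem_Ioi] at hy
    have hY := recipS_pos hβ1 one_pos
    set M := 1 + y / (β * recipS β 1) with hM
    have hM1 : 1 ≤ M := le_add_of_nonneg_right (by positivity)
    have hle : y ≤ β * (M * recipS β M) := by
      calc y = β * ((M - 1) * recipS β 1) := by rw [hM]; field_simp; ring
        _ ≤ β * (M * recipS β M) := by
          gcongr
          · linarith
          · exact (strictMono_recipS hβ1).monotone hM1
    obtain ⟨t, ht, hty⟩ := intermediate_value_Icc (zero_le_one.trans hM1)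
      (f := fun t => β * (t * recipS β t))
      (continuous_const.mul (continuous_id.mul (continuous_recipS hβ1))).continuousOn
      (mem_Icc.mpr ⟨by simpa using hy.le, hle⟩)
    refine ⟨t, ht.1.lt_of_ne ?_, hty⟩
    rintro rfl
    simp at hty
    exact hy.ne hty

/-- The inverse on `(0, ∞)` of `t ↦ β t recipS β t`. -/
lemma exists_inverse_mul_recipS (hβ : 0 < β) (hβ1 : β ≤ 1) :
    ∃ g : ℝ → ℝ, ∀ y, 0 < y → 0 < g y ∧ β * (g y * recipS β (g y)) = y ∧
      HasDerivAt g (β * (recipS β (g y) * (Real.sinh (g y) * rootS β (g y) + g y) /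
        (Real.sinh (g y) * rootS β (g y))))⁻¹ y := by
  have hsurj : ∀ y : ℝ, ∃ t, 0 < y → 0 < t ∧ β * (t * recipS β t) = y := fun y => by
    by_cases hy : 0 < y
    · obtain ⟨t, ht, hty⟩ := (image_mul_recipS hβ hβ1).ge (mem_Ioi.mpr hy)
      exact ⟨t, fun _ => ⟨ht, hty⟩⟩
    · exact ⟨0, fun h => (hy h).elim⟩
  choose g hg using hsurj
  have hmono := strictMonoOn_mul_recipS hβ hβ1
  have hgmono : StrictMonoOn g (Ioi 0) := fun y hy z hz hyz => by
    rwa [← hmono.lt_iff_lt (hg y hy).1 (hg z hz).1, (hg y hy).2, (hg z hz).2]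
  have himage : g '' Ioi 0 = Ioi 0 := by
    refine Subset.antisymm ?_ fun t ht => ?_
    · rintro _ ⟨y, hy, rfl⟩
      exact (hg y hy).1
    · have hy : 0 < β * (t * recipS β t) := mul_pos hβ (mul_pos ht (recipS_pos hβ1 ht))
      exact ⟨_, hy, hmono.injOn (hg _ hy).1 ht (hg _ hy).2⟩
  refine ⟨g, fun y hy => ⟨(hg y hy).1, (hg y hy).2, ?_⟩⟩
  have hpos := (hg y hy).1
  have hcont : ContinuousAt g y := hgmono.continuousAt_of_image_mem_nhds (Ioi_mem_nhds hy)
    (by rw [himage]; exact Ioi_mem_nhds hpos)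
  refine HasDerivAt.of_local_left_inverse hcont (hasDerivAt_mul_recipS hβ1 hpos) ?_ ?_
  · have hm := hpos.trans (self_lt_sinh_mul_rootS hβ1 hpos)
    have hY := recipS_pos hβ1 hpos
    positivity
  · filter_upwards [Ioi_mem_nhds hy] with z hz using (hg z hz).2

/-- Along the curve `β s recipS β s = (dslope (recipS β) 0 t)⁻¹`, the quantity
`recipS β t + (β recipS β s)⁻¹` increases strictly with `t`. -/
lemma recipS_add_inv_lt (hβ : 0 < β) (hβ1 : β ≤ 1) {s₁ s₂ t₁ t₂ : ℝ}
    (hs₁ : 0 < s₁) (hs₂ : 0 < s₂) (ht₁ : 0 ≤ t₁) (ht : t₁ < t₂)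
    (h₁ : β * (s₁ * recipS β s₁) = (dslope (recipS β) 0 t₁)⁻¹)
    (h₂ : β * (s₂ * recipS β s₂) = (dslope (recipS β) 0 t₂)⁻¹) :
    recipS β t₁ + (β * recipS β s₁)⁻¹ < recipS β t₂ + (β * recipS β s₂)⁻¹ := by
  obtain ⟨g, hg⟩ := exists_inverse_mul_recipS hβ hβ1
  have hr {t : ℝ} (ht : 0 ≤ t) : 0 < (dslope (recipS β) 0 t)⁻¹ :=
    inv_pos.mpr (dslope_recipS_pos hβ1 ht)
  have hinj := (strictMonoOn_mul_recipS hβ hβ1).injOn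
  have hgs {s t : ℝ} (hs : 0 < s) (ht : 0 ≤ t)
      (h : β * (s * recipS β s) = (dslope (recipS β) 0 t)⁻¹) :
      g (dslope (recipS β) 0 t)⁻¹ = s :=
    hinj (hg _ (hr ht)).1 hs ((hg _ (hr ht)).2.1.trans h.symm)
  rw [← hgs hs₁ ht₁ h₁, ← hgs hs₂ (ht₁.trans ht.le) h₂]
  suffices h : StrictMonoOn
      (fun t => recipS β t + (β * recipS β (g (dslope (recipS β) 0 t)⁻¹))⁻¹) (Ici 0) from
    h ht₁ (ht₁.trans ht.le) ht
  refine strictMonoOn_of_deriv_pos (convex_Ici 0) ?_ fun t ht => ?_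
  · refine (continuous_recipS hβ1).continuousOn.add (ContinuousOn.inv₀ (continuousOn_const.mul
      ((continuous_recipS hβ1).comp_continuousOn fun t ht => ?_)) fun t ht =>
        (mul_pos hβ (recipS_pos hβ1 (hg _ (hr ht)).1)).ne')
    exact (hg _ (hr ht)).2.2.continuousAt.comp_continuousWithinAt
      (f := fun t => (dslope (recipS β) 0 t)⁻¹) (continuousOn_inv_dslope_recipS hβ1 t ht)
  · rw [interior_Ici, mem_Ioi] at ht
    obtain ⟨hs, hcurve, hgd⟩ := hg _ (hr ht.le)
    have hgr := HasDerivAt.comp t hgd (hasDerivAt_inv_dslope_recipS hβ1 ht)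
    have hYg := (HasDerivAt.comp t (hasDerivAt_recipS_of_pos hβ1 hs) hgr).const_mul β
    have hd := (hasDerivAt_recipS_of_pos hβ1 ht).add
      (hYg.fun_inv (mul_pos hβ (recipS_pos hβ1 hs)).ne')
    refine hd.deriv.ge.trans_lt' ?_
    simp only [Function.comp_apply]
    set s := g (dslope (recipS β) 0 t)⁻¹
    rw [dslope_recipS_of_pos ht, inv_div] at hcurve
    have hYt := recipS_pos hβ1 ht
    have hYs := recipS_pos hβ1 hs
    have hmt := self_lt_sinh_mul_rootS hβ1 ht
    have hms := self_lt_sinh_mul_rootS hβ1 hs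
    have hts : t < s := by
      rw [eq_div_iff hYt.ne'] at hcurve
      calc t = β * (s * (recipS β s * recipS β t)) := by linear_combination -hcurve
        _ ≤ s * (recipS β s * recipS β t) := mul_le_of_le_one_left (by positivity) hβ1
        _ < s := mul_lt_of_lt_one_right hs
          (mul_lt_one_of_nonneg_of_lt_one_left hYs.le (recipS_lt_one hβ1 s)
            (recipS_lt_one hβ1 t).le)
    have hmono := monotoneOn_sinh_mul_rootS_sub_div_sq hβ1 ht hs hts.le
    simp only at hmono
    rw [div_le_div_iff₀ (by positivity) (by positivity)] at hmono
    set m := Real.sinh t * rootS β t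
    set n := Real.sinh s * rootS β s
    have hm : 0 < m := ht.trans hmt
    have hn : 0 < n := hs.trans hms
    have key : 0 < recipS β t / (m * t ^ 2 * (n + s)) * (t ^ 2 * (n + s) - (m - t) * s ^ 2) := by
      refine mul_pos (by positivity) ?_
      nlinarith [mul_pos (pow_pos ht 2) hs]
    refine key.trans_eq ?_
    have hβeq : β = t / (s * recipS β t * recipS β s) := by
      rw [eq_div_iff (by positivity)] at hcurve ⊢
      linarith
    generalize recipS β t = A at *
    generalize recipS β s = B at *
    rw [hβeq]
    field_simp
    ring

lemma rs_mul_recipS (hβ1 : β ≤ 1) {b x : ℝ} (hb : 0 ≤ b) (hx : 0 < x) :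
    RS β b x * recipS β (b * x) = b := by
  rcases hb.eq_or_lt with rfl | hb
  · rw [zero_mul, recipS_zero, mul_zero]
  · rw [RS, if_neg hb.ne', mul_assoc, recipS_mul_coth_add hβ1 (mul_pos hb hx), mul_one]

lemma mul_rs_eq_inv_dslope (hβ1 : β ≤ 1) {b x : ℝ} (hb : 0 ≤ b) (hx : 0 < x) :
    x * RS β b x = (dslope (recipS β) 0 (b * x))⁻¹ := by
  rcases hb.eq_or_lt with rfl | hb
  · rw [zero_mul, dslope_recipS_zero hβ1, RS, if_pos rfl]
    field_simp
  · have h := rs_mul_recipS hβ1 hb.le hx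
    have hY := recipS_pos hβ1 (mul_pos hb hx)
    rw [dslope_recipS_of_pos (mul_pos hb hx), inv_div, eq_div_iff hY.ne']
    linear_combination x * h

end

theorem u_strict_increase (β : ℝ) (hβ : 0 < β) (hβ1 : β ≤ 1)
    (a b c : ℝ) (hab : b < a) (hbc : c ≤ b) (hc : 0 < c)
    (x₁ x₂ : ℝ) (hx₁ : 0 < x₁) (hx₂ : 0 < x₂)
    (h₁ : a * (coth (a * x₁) - Real.sqrt ((coth (a * x₁)) ^ 2 - β)) = RS β b x₁)
    (h₂ : (a + c) * (coth ((a + c) * x₂) - Real.sqrt ((coth ((a + c) * x₂)) ^ 2 - β))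
          = RS β (b - c) x₂) :
    a * (coth (a * x₁) - Real.sqrt ((coth (a * x₁)) ^ 2 - β)) <
      (a + c) * (coth ((a + c) * x₂) - Real.sqrt ((coth ((a + c) * x₂)) ^ 2 - β)) := by
  have ha : 0 < a := hc.trans_le (hbc.trans hab.le)
  have hb : 0 < b := hc.trans_le hbc
  have hs₁ : 0 < a * x₁ := mul_pos ha hx₁
  have hs₂ : 0 < (a + c) * x₂ := by positivity
  have ht₁ : 0 < b * x₁ := mul_pos hb hx₁
  have ht₂ : 0 ≤ (b - c) * x₂ := mul_nonneg (sub_nonneg.mpr hbc) hx₂.le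
  rw [coth_sub_eq hβ1 hs₁] at h₁ ⊢
  rw [coth_sub_eq hβ1 hs₂] at h₂ ⊢
  have hY₁ := recipS_pos hβ1 hs₁
  have hY₂ := recipS_pos hβ1 hs₂
  have hr₁ := mul_rs_eq_inv_dslope hβ1 hb.le hx₁
  have hr₂ := mul_rs_eq_inv_dslope hβ1 (sub_nonneg.mpr hbc) hx₂
  have hR₁ := rs_mul_recipS hβ1 hb.le hx₁
  have hR₂ := rs_mul_recipS hβ1 (sub_nonneg.mpr hbc) hx₂
  rw [← h₁] at hr₁ hR₁
  rw [← h₂] at hr₂ hR₂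
  have hcurve₁ : β * (a * x₁ * recipS β (a * x₁)) = (dslope (recipS β) 0 (b * x₁))⁻¹ := by
    linear_combination hr₁
  have hcurve₂ : β * ((a + c) * x₂ * recipS β ((a + c) * x₂)) =
      (dslope (recipS β) 0 ((b - c) * x₂))⁻¹ := by
    linear_combination hr₂
  have hlt : (b - c) * x₂ < b * x₁ := by
    by_contra! hle
    have hs : a * x₁ ≤ (a + c) * x₂ := by
      rw [← (strictMonoOn_mul_recipS hβ hβ1).le_iff_le hs₁ hs₂]
      simp only [hcurve₁, hcurve₂]
      exact (strictMonoOn_inv_dslope_recipS hβ1).monotoneOn ht₁.le ht₂ hle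
    have hmono := (strictMono_recipS hβ1).monotone
    have hprod : recipS β (a * x₁) * recipS β (b * x₁) ≤
        recipS β ((a + c) * x₂) * recipS β ((b - c) * x₂) :=
      mul_le_mul (hmono hs) (hmono hle) (recipS_pos hβ1 ht₁).le hY₂.le
    have hratio : b * (a + c) ≤ a * (b - c) := by
      have h := mul_le_mul_of_nonneg_left hprod (by positivity : 0 ≤ β * a * (a + c))
      nlinarith
    nlinarith
  have hT := recipS_add_inv_lt hβ hβ1 hs₂ hs₁ ht₂ hlt hcurve₂ hcurve₁
  have hu₁ : 0 < a * (β * recipS β (a * x₁)) := by positivity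
  have hu₂ : 0 < (a + c) * (β * recipS β ((a + c) * x₂)) := by positivity
  have hsum₁ : a * (β * recipS β (a * x₁)) *
      (recipS β (b * x₁) + (β * recipS β (a * x₁))⁻¹) = a + b := by
    rw [mul_add, hR₁]; field_simp; ring
  have hsum₂ : (a + c) * (β * recipS β ((a + c) * x₂)) *
      (recipS β ((b - c) * x₂) + (β * recipS β ((a + c) * x₂))⁻¹) = a + b := by
    rw [mul_add, hR₂]; field_simp; ring
  by_contra! hle
  have hpos : 0 < recipS β ((b - c) * x₂) + (β * recipS β ((a + c) * x₂))⁻¹ :=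
    pos_of_mul_pos_right (hsum₂ ▸ add_pos ha hb) hu₂.le
  exact (mul_lt_mul' hle hT hpos.le hu₁).ne (hsum₂.trans hsum₁.symm)
end

section
/- For all integers k ≥ l ≥ 1 and all real T > 0: k/l ≤ (k·tanh(kT/2))/(l·tanh(lT/2)) ≤ k²/l²; moreover (k·tanh(kT/2))/(l·tanh(lT/2)) → k²/l² as T → 0⁺ and (k·tanh(kT/2))/(l·tanh(lT/2)) → k/l as T → +∞. -/
open Real Filter

theorem hasDerivAt_tanh (x : ℝ) : HasDerivAt Real.tanh (1 / Real.cosh x ^ 2) x := by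
  have h := (Real.hasDerivAt_sinh x).div (Real.hasDerivAt_cosh x) (Real.cosh_pos x).ne'
  have e : Real.tanh = Real.sinh / Real.cosh := funext Real.tanh_eq_sinh_div_cosh
  rwa [← sq, ← sq, Real.cosh_sq_sub_sinh_sq, ← e] at h

theorem hasDerivAt_tanh_const_mul (a x : ℝ) :
    HasDerivAt (fun T : ℝ => Real.tanh (a * T)) (1 / Real.cosh (a * x) ^ 2 * a) x := by
  have h := (hasDerivAt_id x).const_mul a
  rw [mul_one] at h
  exact (hasDerivAt_tanh (a * x)).comp x h

theorem strictMono_tanh : StrictMono Real.tanh :=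
  strictMono_of_deriv_pos fun x => by
    rw [(hasDerivAt_tanh x).deriv]
    have := Real.cosh_pos x
    positivity

theorem tanh_pos_of_pos {x : ℝ} (hx : 0 < x) : 0 < Real.tanh x := by
  simpa using strictMono_tanh hx

theorem mul_tanh_le_mul_tanh {a b x : ℝ} (ha : 0 ≤ a) (hab : a ≤ b) (hx : 0 ≤ x) :
    a * Real.tanh (b * x) ≤ b * Real.tanh (a * x) := by
  have hd (y : ℝ) : HasDerivAt (fun T => b * Real.tanh (a * T) - a * Real.tanh (b * T))
      (b * (1 / Real.cosh (a * y) ^ 2 * a) - a * (1 / Real.cosh (b * y) ^ 2 * b)) y :=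
    ((hasDerivAt_tanh_const_mul a y).const_mul b).sub
      ((hasDerivAt_tanh_const_mul b y).const_mul a)
  have hmono : MonotoneOn (fun T => b * Real.tanh (a * T) - a * Real.tanh (b * T))
      (Set.Ici 0) := by
    refine monotoneOn_of_deriv_nonneg (convex_Ici 0)
      (fun y _ => (hd y).continuousAt.continuousWithinAt)
      (fun y _ => (hd y).differentiableAt.differentiableWithinAt) fun y hy => ?_
    rw [interior_Ici, Set.mem_Ioi] at hy
    have hcosh : Real.cosh (a * y) ≤ Real.cosh (b * y) := by
      rw [Real.cosh_le_cosh, abs_of_nonneg (by positivity),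
        abs_of_nonneg (mul_nonneg (ha.trans hab) hy.le)]
      gcongr
    have hpos := Real.cosh_pos (a * y)
    have hinv : 1 / Real.cosh (b * y) ^ 2 ≤ 1 / Real.cosh (a * y) ^ 2 := by gcongr
    rw [(hd y).deriv]
    nlinarith [mul_le_mul_of_nonneg_left hinv (mul_nonneg ha (ha.trans hab))]
  simpa using hmono Set.self_mem_Ici hx hx

theorem tendsto_tanh_const_mul_div (a : ℝ) :
    Tendsto (fun T : ℝ => Real.tanh (a * T) / T) (nhdsWithin 0 (Set.Ioi 0)) (nhds a) := by
  have h := (hasDerivAt_tanh_const_mul a 0).tendsto_slope_zero_right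
  simpa [div_eq_inv_mul] using h

theorem tendsto_tanh_atTop : Tendsto Real.tanh atTop (nhds 1) := by
  have he : Tendsto (fun x : ℝ => Real.exp (-x) * Real.exp (-x)) atTop (nhds (0 * 0)) :=
    Real.tendsto_exp_neg_atTop_nhds_zero.mul Real.tendsto_exp_neg_atTop_nhds_zero
  have h := (he.const_sub 1).div (he.const_add 1) (by norm_num)
  norm_num at h
  refine h.congr fun x => ?_
  rw [Real.tanh_eq, Pi.div_apply, Real.exp_neg]
  have := Real.exp_pos x
  field_simp

theorem tanh_ratio_bounds_and_limits (k l : ℕ) (hl : 1 ≤ l) (hkl : l ≤ k) :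
    (∀ T : ℝ, 0 < T →
      (k : ℝ) / l ≤ (k * Real.tanh (k * T / 2)) / (l * Real.tanh (l * T / 2)) ∧
      (k * Real.tanh (k * T / 2)) / (l * Real.tanh (l * T / 2)) ≤ (k : ℝ) ^ 2 / l ^ 2) ∧
    Tendsto (fun T : ℝ => ((k : ℝ) * Real.tanh (k * T / 2)) / (l * Real.tanh (l * T / 2)))
      (nhdsWithin 0 (Set.Ioi 0)) (nhds ((k : ℝ) ^ 2 / l ^ 2)) ∧
    Tendsto (fun T : ℝ => ((k : ℝ) * Real.tanh (k * T / 2)) / (l * Real.tanh (l * T / 2)))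
      atTop (nhds ((k : ℝ) / l)) := by
  have hl0 : (0 : ℝ) < l := by exact_mod_cast hl
  have hkl' : (l : ℝ) ≤ k := by exact_mod_cast hkl
  have hk0 : (0 : ℝ) < k := hl0.trans_le hkl'
  refine ⟨fun T hT => ?_, ?_, ?_⟩
  · have hpos : 0 < Real.tanh (l * T / 2) := tanh_pos_of_pos (by positivity)
    have hle : Real.tanh (l * T / 2) ≤ Real.tanh (k * T / 2) :=
      strictMono_tanh.monotone (by gcongr)
    have hmul := mul_tanh_le_mul_tanh hl0.le hkl' (half_pos hT).le
    rw [← mul_div_assoc, ← mul_div_assoc] at hmul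
    constructor
    · rw [div_le_div_iff₀ hl0 (by positivity)]
      nlinarith [mul_le_mul_of_nonneg_left hle (mul_nonneg hk0.le hl0.le)]
    · rw [div_le_div_iff₀ (by positivity) (by positivity)]
      nlinarith [mul_le_mul_of_nonneg_left hmul (mul_nonneg hk0.le hl0.le)]
  · have h := ((tendsto_tanh_const_mul_div ((k : ℝ) / 2)).const_mul (k : ℝ)).div
      ((tendsto_tanh_const_mul_div ((l : ℝ) / 2)).const_mul (l : ℝ)) (by positivity)
    have e : (k : ℝ) * (k / 2) / (l * (l / 2)) = (k : ℝ) ^ 2 / l ^ 2 := by field_simp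
    rw [e] at h
    refine h.congr' ?_
    filter_upwards [self_mem_nhdsWithin] with T hT
    have hT0 : T ≠ 0 := ne_of_gt hT
    rw [Pi.div_apply, ← mul_div_assoc, ← mul_div_assoc, div_div_div_cancel_right₀ hT0,
      div_mul_eq_mul_div, div_mul_eq_mul_div]
  · have ht {a : ℝ} (ha : 0 < a) : Tendsto (fun T : ℝ => Real.tanh (a * T / 2)) atTop (nhds 1) :=
      tendsto_tanh_atTop.comp ((tendsto_id.const_mul_atTop ha).atTop_div_const two_pos)
    have h := ((ht hk0).const_mul (k : ℝ)).div ((ht hl0).const_mul (l : ℝ)) (by positivity)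
    rwa [mul_one, mul_one] at h
end
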